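/- As ℓ → ∞ over positive integers, ∫₀^{π/2} [P_ℓ'(cos φ)]⁴ · sin φ dφ = O(ℓ⁶), i.e. there is a constant C > 0 such that the integral is at most C·ℓ⁶ for all large ℓ. -/

import Mathlib

open Real

/-- The `ℓ`-th Legendre polynomial via Rodrigues' formula:
`P_ℓ(x) = (1/(2^ℓ ℓ!)) (d/dx)^ℓ (x²−1)^ℓ`. -/
noncomputable def legendreP (l : ℕ) (x : ℝ) : ℝ :=
  (1 / (2 ^ l * (Nat.factorial l : ℝ))) * iteratedDeriv l (fun y => (y ^ 2 - 1) ^ l) x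

open Polynomial in
lemma iterDeriv_poly (p : ℝ[X]) (n : ℕ) :
    iteratedDeriv n (fun x => p.eval x) = fun x => (derivative^[n] p).eval x := by
  induction n with
  | zero => simp
  | succ n ih =>
    rw [iteratedDeriv_succ, ih, Function.iterate_succ_apply']
    funext x
    exact Polynomial.deriv _

open Polynomial in
/-- Legendre polynomial as a polynomial. -/
noncomputable def legPoly (l : ℕ) : ℝ[X] :=
  C (1 / (2 ^ l * (Nat.factorial l : ℝ))) * derivative^[l] ((X ^ 2 - 1) ^ l)

open Polynomial in
lemma legendreP_eq (l : ℕ) : legendreP l = fun x => (legPoly l).eval x := by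
  funext x
  have h := congrFun (iterDeriv_poly (((X : ℝ[X]) ^ 2 - 1) ^ l) l) x
  simp only [eval_pow, eval_sub, eval_X, eval_one] at h
  simp only [legendreP, legPoly, eval_mul, eval_C, h]

open Polynomial in
lemma legPoly_one (l : ℕ) : (legPoly l).eval 1 = 1 := by
  have hp : ((X : ℝ[X]) ^ 2 - 1) ^ l = (X - C 1) ^ l * (X + 1) ^ l := by
    rw [← mul_pow]; congr 1; simp only [C_1]; ring
  have h := aeval_iterate_derivative_self (A := ℝ) (((X : ℝ[X]) ^ 2 - 1) ^ l) l (1 : ℝ)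
    (p' := (X + 1) ^ l) (by simpa using hp)
  simp only [coe_aeval_eq_eval] at h
  simp only [legPoly, eval_mul, eval_C, h]
  have : (Nat.factorial l : ℝ) ≠ 0 := by positivity
  simp only [eval_pow, eval_add, eval_X, eval_one, nsmul_eq_mul]
  norm_num
  field_simp

open Polynomial in
lemma rod_ode (l n : ℕ) :
    ((X : ℝ[X]) ^ 2 - 1) * derivative^[n + 2] (((X : ℝ[X]) ^ 2 - 1) ^ l)
      + 2 * ((n : ℝ[X]) + 1) * X * derivative^[n + 1] (((X : ℝ[X]) ^ 2 - 1) ^ l)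
      + ((n : ℝ[X]) + 1) * (n : ℝ[X]) * derivative^[n] (((X : ℝ[X]) ^ 2 - 1) ^ l)
      = 2 * (l : ℝ[X]) * (X * derivative^[n + 1] (((X : ℝ[X]) ^ 2 - 1) ^ l)
        + ((n : ℝ[X]) + 1) * derivative^[n] (((X : ℝ[X]) ^ 2 - 1) ^ l)) := by
  have hC : (C 2 : ℝ[X]) = 2 := rfl
  induction n with
  | zero =>
    have h0 : ((X : ℝ[X]) ^ 2 - 1) * derivative (((X : ℝ[X]) ^ 2 - 1) ^ l)
        = 2 * (l : ℝ[X]) * X * (X ^ 2 - 1) ^ l := by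
      cases l with
      | zero => simp
      | succ m =>
        rw [derivative_pow]
        simp [hC]
        ring
    have h1 := congrArg derivative h0
    simp only [Function.iterate_succ_apply', Function.iterate_zero_apply] at *
    generalize ((X : ℝ[X]) ^ 2 - 1) ^ l = q at *
    simp [derivative_mul, derivative_pow, hC] at h1
    push_cast
    linear_combination h1
  | succ n ih =>
    have h1 := congrArg derivative ih
    simp only [Function.iterate_succ_apply'] at *
    generalize derivative^[n] (((X : ℝ[X]) ^ 2 - 1) ^ l) = q at *
    simp [derivative_mul, derivative_pow, hC] at h1
    push_cast
    linear_combination h1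

open Polynomial in
lemma leg_ode (l : ℕ) :
    ((X : ℝ[X]) ^ 2 - 1) * derivative (derivative (legPoly l))
      + 2 * X * derivative (legPoly l) = (l : ℝ[X]) * ((l : ℝ[X]) + 1) * legPoly l := by
  have h := rod_ode l l
  simp only [Function.iterate_succ_apply'] at h
  simp only [legPoly, derivative_C_mul]
  linear_combination (C (1 / (2 ^ l * (Nat.factorial l : ℝ)))) * h

open Polynomial in
lemma leg_ode2 (l : ℕ) :
    ((X : ℝ[X]) ^ 2 - 1) * derivative (derivative (derivative (legPoly l)))
      + 4 * X * derivative (derivative (legPoly l))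
      = ((l : ℝ[X]) * ((l : ℝ[X]) + 1) - 2) * derivative (legPoly l) := by
  have hC : (C 2 : ℝ[X]) = 2 := rfl
  have h1 := congrArg derivative (leg_ode l)
  generalize legPoly l = q at *
  simp [derivative_mul, derivative_pow, hC] at h1
  linear_combination h1

open Polynomial in
/-- Energy bound for solutions of `(x²-1) v'' + k x v' = M v`, `k ≥ 1`. -/
lemma energy (v : ℝ[X]) (k M : ℝ) (hk : 1 ≤ k)
    (h : ((X : ℝ[X]) ^ 2 - 1) * derivative (derivative v)
      + C k * X * derivative v = C M * v) (x : ℝ) (h0 : 0 ≤ x) (h1 : x ≤ 1) :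
    M * (v.eval x) ^ 2 + (1 - x ^ 2) * ((derivative v).eval x) ^ 2 ≤ M * (v.eval 1) ^ 2 := by
  set e : ℝ[X] := C M * v ^ 2 + (1 - X ^ 2) * (derivative v) ^ 2 with he
  have hd : derivative e = C (2 * (k - 1)) * X * (derivative v) ^ 2 := by
    rw [he]
    simp [derivative_mul, derivative_pow]
    have : (C 2 : ℝ[X]) = 2 := rfl
    rw [this]
    linear_combination (-2 * derivative v) * h
  have hm : MonotoneOn (fun y => e.eval y) (Set.Icc 0 1) := by
    apply monotoneOn_of_deriv_nonneg (convex_Icc 0 1) e.continuous.continuousOn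
      e.differentiable.differentiableOn
    intro y hy
    rw [interior_Icc] at hy
    rw [Polynomial.deriv, hd]
    simp only [eval_mul, eval_C, eval_X, eval_pow]
    have := hy.1.le
    have : 0 ≤ k - 1 := by linarith
    positivity
  have := hm ⟨h0, h1⟩ (Set.right_mem_Icc.2 zero_le_one) h1
  simpa [he] using this

open Polynomial in
lemma leg_bounds (l : ℕ) (hl : 2 ≤ l) (x : ℝ) (h0 : 0 ≤ x) (h1 : x ≤ 1) :
    (1 - x) * ((derivative (legPoly l)).eval x) ^ 2 ≤ l * (l + 1) ∧
    ((derivative (legPoly l)).eval x) ^ 2 ≤ (l * (l + 1)) ^ 2 := by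
  have hl' : (2 : ℝ) ≤ l := by exact_mod_cast hl
  have e1 := energy (legPoly l) 2 (l * (l + 1)) (by norm_num)
    (by have := leg_ode l; have h2 : (C 2 : ℝ[X]) = 2 := rfl; simpa [h2] using this) x h0 h1
  have e2 := energy (derivative (legPoly l)) 4 (l * (l + 1) - 2) (by norm_num)
    (by
      have := leg_ode2 l
      have h2 : (C 2 : ℝ[X]) = 2 := rfl
      have h4 : (C 4 : ℝ[X]) = 4 := rfl
      simpa [h2, h4] using this) x h0 h1
  have e3 := congrArg (Polynomial.eval 1) (leg_ode l)
  simp [legPoly_one] at e3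
  rw [legPoly_one] at e1
  set a := (derivative (legPoly l)).eval x
  have hx : 0 ≤ 1 - x := by linarith
  have hx2 : 1 - x ≤ 1 - x ^ 2 := by nlinarith
  refine ⟨?_, ?_⟩
  · have : (1 - x) * a ^ 2 ≤ (1 - x ^ 2) * a ^ 2 := by gcongr
    have : 0 ≤ (l * (l + 1) : ℝ) * (eval x (legPoly l)) ^ 2 := by positivity
    linarith
  · have hM : 0 < (l * (l + 1) - 2 : ℝ) := by nlinarith
    have h3 : 0 ≤ (1 - x ^ 2) * (eval x (derivative (derivative (legPoly l)))) ^ 2 :=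
      mul_nonneg (by linarith) (sq_nonneg _)
    have h4 : a ^ 2 ≤ (eval 1 (derivative (legPoly l))) ^ 2 :=
      le_of_mul_le_mul_left (by linarith) hM
    have : eval 1 (derivative (legPoly l)) = l * (l + 1) / 2 := by linarith
    rw [this] at h4
    nlinarith [sq_nonneg (l * (l + 1) : ℝ)]

/-- As `ℓ → ∞`, `∫₀^{π/2} [P_ℓ'(cos φ)]⁴ sin φ dφ = O(ℓ⁶)`. -/
theorem integral_fourth_power_legendre_deriv_bigO :
    ∃ C > (0 : ℝ), ∃ l₀ : ℕ, ∀ l : ℕ, l₀ ≤ l →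
      (∫ φ in (0 : ℝ)..(π / 2), (deriv (legendreP l) (Real.cos φ)) ^ 4 * Real.sin φ)
        ≤ C * (l : ℝ) ^ 6 := by
  refine ⟨32, by norm_num, 2, fun l hl => ?_⟩
  have hl' : (2 : ℝ) ≤ l := by exact_mod_cast hl
  obtain ⟨L, hL⟩ : ∃ L : ℝ, L = l * (l + 1) := ⟨_, rfl⟩
  have hL0 : 0 < L := by rw [hL]; positivity
  have hL2 : L ≤ 2 * (l : ℝ) ^ 2 := by rw [hL]; nlinarith
  have hpos : ∀ φ : ℝ, 0 < 1 + L * (1 - cos φ) := fun φ => by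
    have : 0 ≤ 1 - cos φ := by linarith [cos_le_one φ]
    positivity
  have hder : ∀ φ : ℝ, HasDerivAt (fun t => -(4 * L ^ 3) / (1 + L * (1 - cos t)))
      (4 * L ^ 4 * sin φ / (1 + L * (1 - cos φ)) ^ 2) φ := fun φ => by
    have h1 : HasDerivAt (fun t => 1 + L * (1 - cos t)) (L * sin φ) φ := by
      have := (((hasDerivAt_cos φ).const_sub 1).const_mul L).const_add 1
      simpa using this
    have h2 := (hasDerivAt_const φ (-(4 * L ^ 3))).div h1 (hpos φ).ne'
    have h3 : (0 * (1 + L * (1 - cos φ)) - -(4 * L ^ 3) * (L * sin φ))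
        / (1 + L * (1 - cos φ)) ^ 2 = 4 * L ^ 4 * sin φ / (1 + L * (1 - cos φ)) ^ 2 := by
      congr 1
      ring
    rw [← h3]
    exact h2
  have hcont : Continuous (fun φ : ℝ => 4 * L ^ 4 * sin φ / (1 + L * (1 - cos φ)) ^ 2) :=
    Continuous.div (by fun_prop) (by fun_prop) (fun φ => (pow_pos (hpos φ) 2).ne')
  have hint := intervalIntegral.integral_eq_sub_of_hasDerivAt (a := 0) (b := π / 2)
    (fun φ _ => hder φ) (hcont.intervalIntegrable _ _)
  have hD : ∀ x, deriv (legendreP l) x = (Polynomial.derivative (legPoly l)).eval x :=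
    fun x => by rw [legendreP_eq]; exact Polynomial.deriv _
  simp only [hD]
  calc _ ≤ ∫ φ in (0 : ℝ)..(π / 2), 4 * L ^ 4 * sin φ / (1 + L * (1 - cos φ)) ^ 2 := by
        apply intervalIntegral.integral_mono_on (by positivity)
        · apply Continuous.intervalIntegrable
          have := (Polynomial.derivative (legPoly l)).continuous.comp continuous_cos
          exact (this.pow 4).mul continuous_sin
        · exact hcont.intervalIntegrable _ _
        intro φ hφ
        have hs : 0 ≤ sin φ := sin_nonneg_of_nonneg_of_le_pi hφ.1 (by linarith [hφ.2, pi_pos])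
        have hc : 0 ≤ cos φ := cos_nonneg_of_mem_Icc ⟨by linarith [hφ.1, pi_pos], hφ.2⟩
        obtain ⟨b1, b2⟩ := leg_bounds l hl (cos φ) hc (cos_le_one φ)
        rw [← hL] at b1 b2
        generalize (Polynomial.derivative (legPoly l)).eval (cos φ) = a at *
        have hy : 0 ≤ 1 - cos φ := by linarith [cos_le_one φ]
        have hp := hpos φ
        generalize 1 - cos φ = y at *
        rw [mul_div_right_comm]
        gcongr
        rw [le_div_iff₀ (by positivity)]
        have c1 : (a ^ 2) ^ 2 ≤ (L ^ 2) ^ 2 := by gcongr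
        have c2 : (y * a ^ 2) ^ 2 ≤ L ^ 2 := by gcongr
        have c3 : L ^ 2 * (y * a ^ 2) ^ 2 ≤ L ^ 2 * L ^ 2 := by gcongr
        have c4 : a ^ 4 * (1 + L * y) ^ 2 ≤ a ^ 4 * (2 * (1 + L ^ 2 * y ^ 2)) := by
          gcongr
          nlinarith [sq_nonneg (1 - L * y)]
        nlinarith
    _ ≤ 4 * L ^ 3 := by
        rw [hint]
        simp only [cos_pi_div_two, cos_zero]
        have : 0 ≤ 4 * L ^ 3 / (1 + L * (1 - 0)) := by positivity
        rw [neg_div]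
        norm_num at this ⊢
        linarith
    _ ≤ 4 * (2 * (l : ℝ) ^ 2) ^ 3 := by gcongr
    _ = 32 * (l : ℝ) ^ 6 := by ring
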